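/- arXiv:2007.15387 — 6 statements merged into one kernel-verified Lean document; each statement's English description precedes it below -/
import Mathlib

section
/- Let κ, T₁, T₂ > 0, let ρ : [0,1] → [0,∞) and T : [0,1] → (0,∞) be measurable with C₋, C₊ finite and C₁C₂ ≠ 1. Let f : [0,1] × ℝ → [0,∞) be such that v ↦ |v| f(0,v) is integrable on (−∞,0) and v ↦ |v| f(1,v) is integrable on (0,∞), and suppose: (i) for a.e. v < 0, f(0,v) = e^{−1/(κ|v|)} f(1,v) + ∫₀¹ (1/(κ|v|)) e^{−y/(κ|v|)} ρ(y) M_{T(y)}(v) dy; (ii) for a.e. v > 0, f(1,v) = e^{−1/(κv)} f(0,v) + ∫₀¹ (1/(κv)) e^{−(1−y)/(κv)} ρ(y) M_{T(y)}(v) dy; (iii) for a.e. v > 0, f(0,v) = M̃_{T₁}(v) ∫_{v'<0} |v'| f(0,v') dv', and for a.e. v < 0, f(1,v) = M̃_{T₂}(v) ∫_{v'>0} |v'| f(1,v') dv'. Then ∫_{v<0} |v| f(0,v) dv = (C₋ + C₂C₊)/(1 − C₁C₂) and ∫_{v>0} |v| f(1,v) dv = (C₊ + C₁C₋)/(1 −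 C₁C₂). -/
open MeasureTheory Real Set

/-- Centered Maxwellian with temperature `T`: `M_T(v) = (2πT)^{-1/2} exp(−v²/(2T))`. -/
noncomputable def Mxw (T v : ℝ) : ℝ :=
  (Real.sqrt (2 * π * T))⁻¹ * Real.exp (-v ^ 2 / (2 * T))

/-- Wall Maxwellian with temperature `T`: `M̃_T(v) = (1/T) exp(−v²/(2T))`,
normalized so that `∫₀^∞ v M̃_T(v) dv = 1`. -/
noncomputable def wallMxw (T v : ℝ) : ℝ :=
  T⁻¹ * Real.exp (-v ^ 2 / (2 * T))

/-- `C_i = ∫₀^∞ v e^{−1/(κv)} M̃_{T_i}(v) dv`. -/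
noncomputable def Cwall (κ T : ℝ) : ℝ :=
  ∫ v in Ioi (0 : ℝ), v * Real.exp (-1 / (κ * v)) * wallMxw T v

/-- `C₋ = (1/κ) ∫₀¹ ρ(y) (∫₀^∞ e^{−y/(κv)} M_{T(y)}(v) dv) dy`. -/
noncomputable def Cminus (κ : ℝ) (ρ T : ℝ → ℝ) : ℝ :=
  κ⁻¹ * ∫ y in Icc (0 : ℝ) 1, ρ y * ∫ v in Ioi (0 : ℝ), Real.exp (-y / (κ * v)) * Mxw (T y) v

/-- `C₊ = (1/κ) ∫₀¹ ρ(y) (∫₀^∞ e^{−(1−y)/(κv)} M_{T(y)}(v) dv) dy`. -/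
noncomputable def Cplus (κ : ℝ) (ρ T : ℝ → ℝ) : ℝ :=
  κ⁻¹ * ∫ y in Icc (0 : ℝ) 1, ρ y * ∫ v in Ioi (0 : ℝ), Real.exp (-(1 - y) / (κ * v)) * Mxw (T y) v

/-- `f` is a mild steady state of the linear BGK equation with data `(κ, T₁, T₂, ρ, T)`. -/
def IsMildSteadyState (κ T₁ T₂ : ℝ) (ρ T : ℝ → ℝ) (f : ℝ → ℝ → ℝ) : Prop :=
  Cwall κ T₁ * Cwall κ T₂ < 1 ∧
  IntegrableOn
    (fun y => ρ y * ∫ v in Ioi (0 : ℝ), Real.exp (-y / (κ * v)) * Mxw (T y) v)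
    (Icc (0 : ℝ) 1) ∧
  IntegrableOn
    (fun y => ρ y * ∫ v in Ioi (0 : ℝ), Real.exp (-(1 - y) / (κ * v)) * Mxw (T y) v)
    (Icc (0 : ℝ) 1) ∧
  (∀ x ∈ Icc (0 : ℝ) 1, ρ x = ∫ v, f x v) ∧
  (∀ x ∈ Icc (0 : ℝ) 1,
    (∀ᵐ v ∂(volume.restrict (Ioi (0 : ℝ))),
      f x v = Real.exp (-x / (κ * v)) * wallMxw T₁ v *
          ((Cminus κ ρ T + Cwall κ T₂ * Cplus κ ρ T) / (1 - Cwall κ T₁ * Cwall κ T₂)) +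
        ∫ y in (0 : ℝ)..x, (κ * v)⁻¹ * Real.exp (-(x - y) / (κ * v)) * ρ y * Mxw (T y) v) ∧
    (∀ᵐ v ∂(volume.restrict (Iio (0 : ℝ))),
      f x v = Real.exp (-(1 - x) / (κ * |v|)) * wallMxw T₂ v *
          ((Cplus κ ρ T + Cwall κ T₁ * Cminus κ ρ T) / (1 - Cwall κ T₁ * Cwall κ T₂)) +
        ∫ y in x..1, (κ * |v|)⁻¹ * Real.exp (-(y - x) / (κ * |v|)) * ρ y * Mxw (T y) v))

theorem Mxw_neg (T v : ℝ) : Mxw T (-v) = Mxw T v := by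
  simp [Mxw]

theorem wallMxw_neg (T v : ℝ) : wallMxw T (-v) = wallMxw T v := by
  simp [wallMxw]

theorem Mxw_nonneg (T v : ℝ) : 0 ≤ Mxw T v := by
  unfold Mxw
  positivity

theorem integrable_Mxw {T : ℝ} (hT : 0 < T) : Integrable (Mxw T) := by
  have h := (integrable_exp_neg_mul_sq (b := (2 * T)⁻¹) (by positivity)).const_mul
    (Real.sqrt (2 * π * T))⁻¹
  refine h.congr (.of_forall fun v => ?_)
  simp only [Mxw]
  congr 2
  ring

theorem integrable_mul_wallMxw {T : ℝ} (hT : 0 < T) : Integrable (fun v => v * wallMxw T v) := by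
  have h := (integrable_mul_exp_neg_mul_sq (b := (2 * T)⁻¹) (by positivity)).const_mul T⁻¹
  refine h.congr (.of_forall fun v => ?_)
  have hexp : -(2 * T)⁻¹ * v ^ 2 = -v ^ 2 / (2 * T) := by ring
  simp only [wallMxw, hexp]
  ring

/-- A damping factor `e^{-a/(κv)}` with `a ≥ 0` preserves integrability on `(0, ∞)`. -/
theorem integrableOn_exp_neg_div_mul {κ a : ℝ} (hκ : 0 < κ) (ha : 0 ≤ a) {g : ℝ → ℝ}
    (hg : IntegrableOn g (Ioi 0)) :
    IntegrableOn (fun v => Real.exp (-a / (κ * v)) * g v) (Ioi 0) := by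
  refine Integrable.bdd_mul (c := 1) hg (Measurable.aestronglyMeasurable (by fun_prop)) ?_
  filter_upwards [ae_restrict_mem measurableSet_Ioi] with v hv
  have hv : 0 < v := hv
  rw [Real.norm_eq_abs, Real.abs_exp, Real.exp_le_one_iff, neg_div, neg_nonpos]
  positivity

theorem integrableOn_mul_exp_mul_wallMxw {κ T : ℝ} (hκ : 0 < κ) (hT : 0 < T) :
    IntegrableOn (fun v => v * Real.exp (-1 / (κ * v)) * wallMxw T v) (Ioi 0) :=
  (integrableOn_exp_neg_div_mul hκ zero_le_one (integrable_mul_wallMxw hT).integrableOn).congr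
    (.of_forall fun v => by ring)

section Source

variable {κ : ℝ} {ρ T a : ℝ → ℝ}

theorem integrable_source_prod (hκ : 0 < κ) (hρ : Measurable ρ) (hρnn : ∀ y, 0 ≤ ρ y)
    (hT : Measurable T) (hTpos : ∀ y, 0 < T y) (ha : Measurable a)
    (hann : ∀ y ∈ Icc (0 : ℝ) 1, 0 ≤ a y)
    (hC : IntegrableOn
      (fun y => ρ y * ∫ v in Ioi (0 : ℝ), Real.exp (-a y / (κ * v)) * Mxw (T y) v)
      (Icc (0 : ℝ) 1)) :
    Integrable (fun p : ℝ × ℝ => ρ p.1 * (Real.exp (-a p.1 / (κ * p.2)) * Mxw (T p.1) p.2))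
      ((volume.restrict (Icc (0 : ℝ) 1)).prod (volume.restrict (Ioi (0 : ℝ)))) := by
  have hmeas : Measurable
      (fun p : ℝ × ℝ => ρ p.1 * (Real.exp (-a p.1 / (κ * p.2)) * Mxw (T p.1) p.2)) := by
    unfold Mxw
    fun_prop
  rw [integrable_prod_iff hmeas.aestronglyMeasurable]
  constructor
  · filter_upwards [ae_restrict_mem measurableSet_Icc] with y hy
    exact (integrableOn_exp_neg_div_mul hκ (hann y hy)
      (integrable_Mxw (hTpos y)).integrableOn).const_mul (ρ y)
  · refine hC.congr (.of_forall fun y => ?_)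
    simp only
    rw [← integral_const_mul]
    congr 1 with v
    rw [Real.norm_of_nonneg
      (mul_nonneg (hρnn y) (mul_nonneg (Real.exp_nonneg _) (Mxw_nonneg _ _)))]

theorem mul_integral_source {v : ℝ} (hv : 0 < v) :
    v * ∫ y in Icc (0 : ℝ) 1, (κ * v)⁻¹ * Real.exp (-a y / (κ * v)) * ρ y * Mxw (T y) v =
      κ⁻¹ * ∫ y in Icc (0 : ℝ) 1, ρ y * (Real.exp (-a y / (κ * v)) * Mxw (T y) v) := by
  rw [← integral_const_mul, ← integral_const_mul]
  congr 1 with y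
  rw [mul_inv]
  field_simp

theorem integrableOn_mul_integral_source (hκ : 0 < κ) (hρ : Measurable ρ) (hρnn : ∀ y, 0 ≤ ρ y)
    (hT : Measurable T) (hTpos : ∀ y, 0 < T y) (ha : Measurable a)
    (hann : ∀ y ∈ Icc (0 : ℝ) 1, 0 ≤ a y)
    (hC : IntegrableOn
      (fun y => ρ y * ∫ v in Ioi (0 : ℝ), Real.exp (-a y / (κ * v)) * Mxw (T y) v)
      (Icc (0 : ℝ) 1)) :
    IntegrableOn (fun v => v * ∫ y in Icc (0 : ℝ) 1,
      (κ * v)⁻¹ * Real.exp (-a y / (κ * v)) * ρ y * Mxw (T y) v) (Ioi 0) := by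
  have h := (integrable_source_prod hκ hρ hρnn hT hTpos ha hann hC).integral_prod_right
  exact IntegrableOn.congr_fun (h.const_mul κ⁻¹)
    (fun v hv => (mul_integral_source hv).symm) measurableSet_Ioi

/-- The flux generated by the source term, computed by exchanging the integrals in `y` and `v`. -/
theorem integral_mul_integral_source (hκ : 0 < κ) (hρ : Measurable ρ) (hρnn : ∀ y, 0 ≤ ρ y)
    (hT : Measurable T) (hTpos : ∀ y, 0 < T y) (ha : Measurable a)
    (hann : ∀ y ∈ Icc (0 : ℝ) 1, 0 ≤ a y)
    (hC : IntegrableOn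
      (fun y => ρ y * ∫ v in Ioi (0 : ℝ), Real.exp (-a y / (κ * v)) * Mxw (T y) v)
      (Icc (0 : ℝ) 1)) :
    ∫ v in Ioi (0 : ℝ), v * ∫ y in Icc (0 : ℝ) 1,
        (κ * v)⁻¹ * Real.exp (-a y / (κ * v)) * ρ y * Mxw (T y) v =
      κ⁻¹ * ∫ y in Icc (0 : ℝ) 1,
        ρ y * ∫ v in Ioi (0 : ℝ), Real.exp (-a y / (κ * v)) * Mxw (T y) v := by
  rw [setIntegral_congr_fun measurableSet_Ioi fun v hv => mul_integral_source hv,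
    integral_const_mul,
    ← integral_integral_swap (integrable_source_prod hκ hρ hρnn hT hTpos ha hann hC)]
  simp only [integral_const_mul]

/-- The outgoing flux at a wall: the part transmitted from the opposite wall, which emits the
Maxwellian of temperature `τ` with flux `m`, plus the part generated by the source term. -/
theorem integral_outgoing_flux {τ : ℝ} (hκ : 0 < κ) (hτ : 0 < τ) (m : ℝ)
    (hρ : Measurable ρ) (hρnn : ∀ y, 0 ≤ ρ y)
    (hT : Measurable T) (hTpos : ∀ y, 0 < T y) (ha : Measurable a)
    (hann : ∀ y ∈ Icc (0 : ℝ) 1, 0 ≤ a y)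
    (hC : IntegrableOn
      (fun y => ρ y * ∫ v in Ioi (0 : ℝ), Real.exp (-a y / (κ * v)) * Mxw (T y) v)
      (Icc (0 : ℝ) 1)) :
    ∫ v in Ioi (0 : ℝ), v * (Real.exp (-1 / (κ * v)) * (wallMxw τ v * m) +
        ∫ y in Icc (0 : ℝ) 1, (κ * v)⁻¹ * Real.exp (-a y / (κ * v)) * ρ y * Mxw (T y) v) =
      Cwall κ τ * m + κ⁻¹ * ∫ y in Icc (0 : ℝ) 1,
        ρ y * ∫ v in Ioi (0 : ℝ), Real.exp (-a y / (κ * v)) * Mxw (T y) v := by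
  rw [← integral_mul_integral_source hκ hρ hρnn hT hTpos ha hann hC, Cwall, ← integral_mul_const,
    ← integral_add ((integrableOn_mul_exp_mul_wallMxw hκ hτ).mul_const m)
      (integrableOn_mul_integral_source hκ hρ hρnn hT hTpos ha hann hC)]
  congr 1 with v
  ring

end Source

/-- closed form for the moments appearing in the boundary conditions. -/
theorem boundary_moments_formula (κ T₁ T₂ : ℝ) (hκ : 0 < κ) (hT₁ : 0 < T₁) (hT₂ : 0 < T₂)
    (ρ T : ℝ → ℝ) (hρmeas : Measurable ρ) (hρnn : ∀ y, 0 ≤ ρ y)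
    (hTmeas : Measurable T) (hTpos : ∀ y, 0 < T y)
    (hCm : IntegrableOn
      (fun y => ρ y * ∫ v in Ioi (0 : ℝ), Real.exp (-y / (κ * v)) * Mxw (T y) v)
      (Icc (0 : ℝ) 1))
    (hCp : IntegrableOn
      (fun y => ρ y * ∫ v in Ioi (0 : ℝ), Real.exp (-(1 - y) / (κ * v)) * Mxw (T y) v)
      (Icc (0 : ℝ) 1))
    (hC12 : Cwall κ T₁ * Cwall κ T₂ ≠ 1)
    (f : ℝ → ℝ → ℝ) (hfnn : ∀ x v, 0 ≤ f x v)
    (hint0 : IntegrableOn (fun v => |v| * f 0 v) (Iio (0 : ℝ)))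
    (hint1 : IntegrableOn (fun v => |v| * f 1 v) (Ioi (0 : ℝ)))
    (hi : ∀ᵐ v ∂(volume.restrict (Iio (0 : ℝ))),
      f 0 v = Real.exp (-1 / (κ * |v|)) * f 1 v +
        ∫ y in Icc (0 : ℝ) 1, (κ * |v|)⁻¹ * Real.exp (-y / (κ * |v|)) * ρ y * Mxw (T y) v)
    (hii : ∀ᵐ v ∂(volume.restrict (Ioi (0 : ℝ))),
      f 1 v = Real.exp (-1 / (κ * v)) * f 0 v +
        ∫ y in Icc (0 : ℝ) 1, (κ * v)⁻¹ * Real.exp (-(1 - y) / (κ * v)) * ρ y * Mxw (T y) v)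
    (hbc0 : ∀ᵐ v ∂(volume.restrict (Ioi (0 : ℝ))),
      f 0 v = wallMxw T₁ v * ∫ v' in Iio (0 : ℝ), |v'| * f 0 v')
    (hbc1 : ∀ᵐ v ∂(volume.restrict (Iio (0 : ℝ))),
      f 1 v = wallMxw T₂ v * ∫ v' in Ioi (0 : ℝ), |v'| * f 1 v') :
    (∫ v in Iio (0 : ℝ), |v| * f 0 v) =
      (Cminus κ ρ T + Cwall κ T₂ * Cplus κ ρ T) / (1 - Cwall κ T₁ * Cwall κ T₂) ∧
    (∫ v in Ioi (0 : ℝ), |v| * f 1 v) =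
      (Cplus κ ρ T + Cwall κ T₁ * Cminus κ ρ T) / (1 - Cwall κ T₁ * Cwall κ T₂) := by
  set m₀ := ∫ v in Iio (0 : ℝ), |v| * f 0 v with hm₀
  set m₁ := ∫ v in Ioi (0 : ℝ), |v| * f 1 v with hm₁
  have h₀ : m₀ = Cwall κ T₂ * m₁ + Cminus κ ρ T := by
    rw [Cminus, ← integral_outgoing_flux (a := fun y => y) hκ hT₂ m₁ hρmeas hρnn hTmeas hTpos
      measurable_id (fun y hy => hy.1) hCm, hm₀]
    have hflip := integral_comp_neg_Iic (0 : ℝ) fun v =>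
      v * (Real.exp (-1 / (κ * v)) * (wallMxw T₂ v * m₁) +
        ∫ y in Icc (0 : ℝ) 1, (κ * v)⁻¹ * Real.exp (-y / (κ * v)) * ρ y * Mxw (T y) v)
    rw [neg_zero, integral_Iic_eq_integral_Iio] at hflip
    rw [← hflip]
    refine integral_congr_ae ?_
    filter_upwards [hi, hbc1, ae_restrict_mem measurableSet_Iio] with v hv hv' hneg
    rw [hv, hv', abs_of_neg hneg]
    simp only [Mxw_neg, wallMxw_neg]
  have h₁ : m₁ = Cwall κ T₁ * m₀ + Cplus κ ρ T := by
    rw [Cplus, ← integral_outgoing_flux (a := fun y => 1 - y) hκ hT₁ m₀ hρmeas hρnn hTmeas hTpos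
      (by fun_prop) (fun y hy => sub_nonneg.2 hy.2) hCp, hm₁]
    refine integral_congr_ae ?_
    filter_upwards [hii, hbc0, ae_restrict_mem measurableSet_Ioi] with v hv hv' hpos
    rw [hv, hv', abs_of_pos hpos]
  have hne : 1 - Cwall κ T₁ * Cwall κ T₂ ≠ 0 := sub_ne_zero.2 hC12.symm
  rw [eq_div_iff hne, eq_div_iff hne]
  constructor
  · linear_combination h₀ + Cwall κ T₂ * h₁
  · linear_combination h₁ + Cwall κ T₁ * h₀
end

section
/- There exist constants Θ ≥ 1 and c > 0 such that for all κ, T₁, T₂ > 0 with κ²T₁ ≥ Θ and T₂ ≥ T₁, one has C₁C₂ < 1 and 1/(1 − C₁C₂) ≤ √(2/π) · (κ √(T₁T₂)/(√T₁ + √T₂)) · (1 + c (κ²T₁)^{−1/4}). -/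
open MeasureTheory Real Set

/-- The Rayleigh-type integral `∫₀^∞ u e^{−ε/u} e^{−u²/2} du`. -/
noncomputable def rayleighExp (ε : ℝ) : ℝ :=
  ∫ u in Ioi (0 : ℝ), u * Real.exp (-ε / u) * Real.exp (-u ^ 2 / 2)

lemma Cwall_eq_rayleighExp {κ T : ℝ} (hT : 0 < T) :
    Cwall κ T = rayleighExp (κ * Real.sqrt T)⁻¹ := by
  have hs : 0 < Real.sqrt T := Real.sqrt_pos.2 hT
  have h := integral_comp_mul_left_Ioi
    (fun v => v * Real.exp (-1 / (κ * v)) * wallMxw T v) 0 hs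
  rw [mul_zero, smul_eq_mul] at h
  have h2 : Cwall κ T = Real.sqrt T * ∫ x in Ioi (0 : ℝ), (Real.sqrt T * x) *
      Real.exp (-1 / (κ * (Real.sqrt T * x))) * wallMxw T (Real.sqrt T * x) := by
    rw [h, Cwall, mul_inv_cancel_left₀ hs.ne']
  rw [h2, rayleighExp, ← integral_const_mul]
  refine setIntegral_congr_fun measurableSet_Ioi fun u _ => ?_
  have e1 : -1 / (κ * (Real.sqrt T * u)) = -(κ * Real.sqrt T)⁻¹ / u := by
    rw [← mul_assoc, neg_div, neg_div, ← div_div, one_div]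
  have e2 : -(Real.sqrt T * u) ^ 2 / (2 * T) = -u ^ 2 / 2 := by
    rw [mul_pow, Real.sq_sqrt hT.le]; field_simp
  simp only [wallMxw, e1, e2]
  have e3 : Real.sqrt T * Real.sqrt T = T := Real.mul_self_sqrt hT.le
  calc _ = (Real.sqrt T * Real.sqrt T) * T⁻¹ *
        (u * Real.exp (-(κ * Real.sqrt T)⁻¹ / u) * Real.exp (-u ^ 2 / 2)) := by ring
    _ = _ := by rw [e3, mul_inv_cancel₀ hT.ne', one_mul]

lemma integrableOn_rpow_mul_exp_neg_sq_div_two {q : ℝ} (hq : -1 < q) :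
    IntegrableOn (fun u : ℝ => u ^ q * Real.exp (-u ^ 2 / 2)) (Ioi 0) := by
  refine (integrableOn_rpow_mul_exp_neg_mul_sq (b := 1 / 2) (by norm_num) hq).congr_fun
    (fun u _ => ?_) measurableSet_Ioi
  simp only
  congr 2; ring

lemma integrableOn_exp_neg_sq_div_two :
    IntegrableOn (fun u : ℝ => Real.exp (-u ^ 2 / 2)) (Ioi 0) := by
  simpa using integrableOn_rpow_mul_exp_neg_sq_div_two (q := 0) (by norm_num)

lemma integrableOn_mul_exp_neg_sq_div_two :
    IntegrableOn (fun u : ℝ => u * Real.exp (-u ^ 2 / 2)) (Ioi 0) := by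
  simpa using integrableOn_rpow_mul_exp_neg_sq_div_two (q := 1) (by norm_num)

lemma integral_exp_neg_sq_div_two_Ioi :
    ∫ u in Ioi (0 : ℝ), Real.exp (-u ^ 2 / 2) = Real.sqrt (π / 2) := by
  have h := integral_gaussian_Ioi (1 / 2)
  have e : ∀ u : ℝ, -(1 / 2) * u ^ 2 = -u ^ 2 / 2 := fun u => by ring
  simp only [e] at h
  rw [h, div_eq_iff two_ne_zero, show π / (1 / 2) = π / 2 * 2 ^ 2 by ring,
    Real.sqrt_mul (by positivity), Real.sqrt_sq two_pos.le]

lemma integral_mul_exp_neg_sq_div_two_Ioi :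
    ∫ u in Ioi (0 : ℝ), u * Real.exp (-u ^ 2 / 2) = 1 := by
  have h := integral_rpow_mul_exp_neg_mul_rpow (p := 2) (q := 1) (b := 1 / 2)
    (by norm_num) (by norm_num) (by norm_num)
  have e : ∀ u : ℝ, -(1 / 2) * u ^ 2 = -u ^ 2 / 2 := fun u => by ring
  simp only [Real.rpow_one, Real.rpow_two, e] at h
  rw [h]
  norm_num [Real.rpow_neg_one]

lemma integrableOn_rayleighExp {ε : ℝ} (hε : 0 ≤ ε) :
    IntegrableOn (fun u : ℝ => u * Real.exp (-ε / u) * Real.exp (-u ^ 2 / 2)) (Ioi 0) := by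
  refine integrableOn_mul_exp_neg_sq_div_two.mono' (by fun_prop) ?_
  filter_upwards [ae_restrict_mem measurableSet_Ioi] with u hu
  have hu : 0 < u := hu
  have : Real.exp (-ε / u) ≤ 1 :=
    Real.exp_le_one_iff.2 (div_nonpos_of_nonpos_of_nonneg (by linarith) hu.le)
  rw [Real.norm_of_nonneg (by positivity)]
  gcongr
  nlinarith

lemma rayleighExp_nonneg (ε : ℝ) : 0 ≤ rayleighExp ε :=
  setIntegral_nonneg measurableSet_Ioi fun u (hu : 0 < u) => by positivity

lemma one_sub_rayleighExp_eq {ε : ℝ} (hε : 0 ≤ ε) :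
    1 - rayleighExp ε = ∫ u in Ioi (0 : ℝ), (u * Real.exp (-u ^ 2 / 2) -
      u * Real.exp (-ε / u) * Real.exp (-u ^ 2 / 2)) := by
  rw [integral_sub integrableOn_mul_exp_neg_sq_div_two (integrableOn_rayleighExp hε),
    integral_mul_exp_neg_sq_div_two_Ioi, rayleighExp]

lemma one_sub_rayleighExp_le {ε : ℝ} (hε : 0 ≤ ε) :
    1 - rayleighExp ε ≤ Real.sqrt (π / 2) * ε := by
  rw [one_sub_rayleighExp_eq hε, ← integral_exp_neg_sq_div_two_Ioi, ← integral_mul_const]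
  refine setIntegral_mono_on
    (integrableOn_mul_exp_neg_sq_div_two.sub (integrableOn_rayleighExp hε))
    (integrableOn_exp_neg_sq_div_two.mul_const _) measurableSet_Ioi fun u (hu : 0 < u) => ?_
  have h := Real.add_one_le_exp (-ε / u)
  have h2 : u * (-ε / u + 1) ≤ u * Real.exp (-ε / u) := by gcongr
  have h3 : u * (-ε / u + 1) = u - ε := by field_simp; ring
  rw [h3] at h2
  nlinarith [Real.exp_pos (-u ^ 2 / 2)]

/-- Since `1 - e^{-x} ≥ x / (1 + x)` and `u + d² ≥ 2 d √u`, the integrand of `1 - rayleighExp`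
is at least `d² - d³ u^{-1/2} / 2` times the Gaussian weight. -/
lemma le_one_sub_rayleighExp {d : ℝ} (hd : 0 < d) :
    Real.sqrt (π / 2) * d ^ 2 -
        (∫ u in Ioi (0 : ℝ), u ^ (-(1 / 2) : ℝ) * Real.exp (-u ^ 2 / 2)) * (d ^ 3 / 2) ≤
      1 - rayleighExp (d ^ 2) := by
  have hi := integrableOn_rpow_mul_exp_neg_sq_div_two (q := -(1 / 2)) (by norm_num)
  have hε : 0 ≤ d ^ 2 := by positivity
  rw [one_sub_rayleighExp_eq hε, ← integral_exp_neg_sq_div_two_Ioi, ← integral_mul_const, ← integral_mul_const,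
    ← integral_sub (integrableOn_exp_neg_sq_div_two.mul_const _) (hi.mul_const _)]
  refine setIntegral_mono_on
    ((integrableOn_exp_neg_sq_div_two.mul_const _).sub (hi.mul_const _))
    (integrableOn_mul_exp_neg_sq_div_two.sub (integrableOn_rayleighExp hε))
    measurableSet_Ioi fun u (hu : 0 < u) => ?_
  have hr : 0 < Real.sqrt u := Real.sqrt_pos.2 hu
  have hr2 : Real.sqrt u ^ 2 = u := Real.sq_sqrt hu.le
  rw [Real.rpow_neg hu.le, ← Real.sqrt_eq_rpow]
  set r := Real.sqrt u
  have h1 : Real.exp (-d ^ 2 / u) ≤ u / (u + d ^ 2) := by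
    have h := Real.add_one_le_exp (d ^ 2 / u)
    rw [neg_div, Real.exp_neg, show u / (u + d ^ 2) = (d ^ 2 / u + 1)⁻¹ by field_simp; ring]
    gcongr
  have h2 : d ^ 2 - r⁻¹ * (d ^ 3 / 2) ≤ u - u * (u / (u + d ^ 2)) := by
    have h4 : u - u * (u / (u + d ^ 2)) = d ^ 2 - d ^ 4 / (u + d ^ 2) := by
      field_simp; ring
    have h5 : d ^ 4 / (u + d ^ 2) ≤ r⁻¹ * (d ^ 3 / 2) := by
      rw [show r⁻¹ * (d ^ 3 / 2) = d ^ 4 / (2 * d * r) by field_simp]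
      gcongr
      nlinarith [sq_nonneg (d - r)]
    linarith
  have h3 : u * Real.exp (-d ^ 2 / u) ≤ u * (u / (u + d ^ 2)) := by gcongr
  nlinarith [Real.exp_pos (-u ^ 2 / 2)]

lemma inv_one_sub_le_one_add_two_mul {x : ℝ} (h0 : 0 ≤ x) (h1 : x ≤ 1 / 2) :
    1 / (1 - x) ≤ 1 + 2 * x := by
  rw [div_le_iff₀ (by linarith)]
  nlinarith

/-- asymptotic upper bound on `1/(1 − C₁C₂)` for large `κ²T₁`. -/
theorem one_div_one_sub_C1C2_upper :
    ∃ Θ c : ℝ, 1 ≤ Θ ∧ 0 < c ∧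
      ∀ κ T₁ T₂ : ℝ, 0 < κ → 0 < T₁ → 0 < T₂ → Θ ≤ κ ^ 2 * T₁ → T₁ ≤ T₂ →
        Cwall κ T₁ * Cwall κ T₂ < 1 ∧
        1 / (1 - Cwall κ T₁ * Cwall κ T₂) ≤
          Real.sqrt (2 / π) * (κ * Real.sqrt (T₁ * T₂) / (Real.sqrt T₁ + Real.sqrt T₂)) *
            (1 + c * (κ ^ 2 * T₁) ^ (-(1 : ℝ) / 4)) := by
  obtain ⟨s, hs⟩ : ∃ s, s = Real.sqrt (π / 2) := ⟨_, rfl⟩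
  have hs0 : 0 < s := hs ▸ Real.sqrt_pos.2 (by positivity)
  obtain ⟨J, hJ⟩ : ∃ J, J = ∫ u in Ioi (0 : ℝ), u ^ (-(1 / 2) : ℝ) * Real.exp (-u ^ 2 / 2) :=
    ⟨_, rfl⟩
  have hJ0 : 0 ≤ J := hJ ▸ setIntegral_nonneg measurableSet_Ioi
    fun u (hu : 0 < u) => by positivity
  obtain ⟨L, hL⟩ : ∃ L, L = J / 2 / s + s := ⟨_, rfl⟩
  have hL0 : 0 < L := by rw [hL]; positivity
  refine ⟨(2 * L) ^ 4 + 1, 2 * L, by linarith [pow_pos (mul_pos two_pos hL0) 4], by positivity,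
    fun κ T₁ T₂ hκ hT₁ hT₂ hΘ hT => ?_⟩
  have hs1 : 0 < Real.sqrt T₁ := Real.sqrt_pos.2 hT₁
  have hs2 : 0 < Real.sqrt T₂ := Real.sqrt_pos.2 hT₂
  have hX : 0 < κ ^ 2 * T₁ := by positivity
  obtain ⟨d, hd⟩ : ∃ d, d = (κ ^ 2 * T₁) ^ (-(1 : ℝ) / 4) := ⟨_, rfl⟩
  have hd0 : 0 < d := hd ▸ Real.rpow_pos_of_pos hX _
  have hd4 : d ^ 4 = (κ ^ 2 * T₁)⁻¹ := by
    rw [hd, ← Real.rpow_natCast, ← Real.rpow_mul hX.le, ← Real.rpow_neg_one]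
    norm_num
  have hd2 : d ^ 2 = (κ * Real.sqrt T₁)⁻¹ := by
    refine (sq_eq_sq₀ (by positivity) (by positivity)).1 ?_
    rw [← pow_mul, hd4, inv_pow, mul_pow, Real.sq_sqrt hT₁.le]
  obtain ⟨e, he⟩ : ∃ e, e = Real.sqrt (κ * Real.sqrt T₂)⁻¹ := ⟨_, rfl⟩
  have he0 : 0 < e := he ▸ Real.sqrt_pos.2 (by positivity)
  have he2 : e ^ 2 = (κ * Real.sqrt T₂)⁻¹ := by rw [he, Real.sq_sqrt (by positivity)]
  have hed : e ≤ d := by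
    refine (sq_le_sq₀ he0.le hd0.le).1 ?_
    rw [he2, hd2]
    gcongr
  have hLd : 2 * (L * d) ≤ 1 := by
    refine (pow_le_one_iff_of_nonneg (by positivity) four_ne_zero).1 ?_
    rw [← mul_assoc, mul_pow, hd4, ← div_eq_mul_inv, div_le_one hX]
    linarith
  have hd1 : d ≤ 1 := by
    refine (pow_le_one_iff_of_nonneg hd0.le four_ne_zero).1 ?_
    rw [hd4]
    exact inv_le_one_of_one_le₀ (by linarith [pow_pos (mul_pos two_pos hL0) 4])
  have hLs : L * s = J / 2 + s ^ 2 := by rw [hL]; field_simp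
  have hup := one_sub_rayleighExp_le (sq_nonneg d)
  have hlo1 := le_one_sub_rayleighExp hd0
  have hlo2 := le_one_sub_rayleighExp he0
  rw [← hJ, ← hs] at hlo1 hlo2
  rw [← hs] at hup
  rw [Cwall_eq_rayleighExp hT₁, Cwall_eq_rayleighExp hT₂, ← hd2, ← he2, ← hd]
  have hC0 := rayleighExp_nonneg (d ^ 2)
  generalize rayleighExp (d ^ 2) = C at *
  generalize rayleighExp (e ^ 2) = D at *
  have hsd : 0 ≤ s - J / 2 * d := by
    have : s * (2 * (L * d)) ≤ s * 1 := by gcongr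
    nlinarith [mul_nonneg hJ0 hd0.le, mul_pos (pow_pos hs0 2) hd0]
  have hD : e ^ 2 * (s - J / 2 * d) ≤ 1 - D := by
    have : e ^ 2 * (J / 2 * e) ≤ e ^ 2 * (J / 2 * d) := by gcongr
    nlinarith
  have hC : 1 - s * d ≤ C := by
    have : s * d ^ 2 ≤ s * d := by
      gcongr
      nlinarith
    linarith
  have hkey : (d ^ 2 + e ^ 2) * s * (1 - L * d) ≤ 1 - C * D := by
    have h1 : (1 - s * d) * (e ^ 2 * (s - J / 2 * d)) ≤ C * (1 - D) :=
      (mul_le_mul_of_nonneg_right hC (by positivity)).trans (mul_le_mul_of_nonneg_left hD hC0)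
    have h2 : (d ^ 2 + e ^ 2) * s * (1 - L * d) =
        d ^ 2 * (s - (L * s) * d) + e ^ 2 * (s - (L * s) * d) := by ring
    rw [h2, hLs]
    have h3 : 0 ≤ d ^ 3 * s ^ 2 := by positivity
    have h4 : 0 ≤ e ^ 2 * (s * d * (J / 2 * d)) := by positivity
    nlinarith
  have hpos : 0 < (d ^ 2 + e ^ 2) * s * (1 - L * d) :=
    mul_pos (by positivity) (by linarith)
  refine ⟨by linarith, (one_div_le_one_div_of_le hpos hkey).trans ?_⟩
  have hinv := inv_one_sub_le_one_add_two_mul (x := L * d) (by positivity) (by linarith)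
  have hs' : Real.sqrt (2 / π) = 1 / s := by
    rw [hs, one_div, ← Real.sqrt_inv, inv_div]
  have hsum : κ * Real.sqrt (T₁ * T₂) / (Real.sqrt T₁ + Real.sqrt T₂) = 1 / (d ^ 2 + e ^ 2) := by
    rw [hd2, he2, Real.sqrt_mul hT₁.le]
    field_simp
    ring
  rw [hs', hsum]
  calc 1 / ((d ^ 2 + e ^ 2) * s * (1 - L * d))
      = 1 / s * (1 / (d ^ 2 + e ^ 2)) * (1 / (1 - L * d)) := by
        rw [← one_div_mul_one_div, ← one_div_mul_one_div]; ring
    _ ≤ 1 / s * (1 / (d ^ 2 + e ^ 2)) * (1 + 2 * L * d) := by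
        rw [mul_assoc 2 L d]
        gcongr
end

section
/- Let κ > 0 and T₁ > 0, let ρ : [0,1] → [0,∞) be measurable with ∫₀¹ ρ(y) dy = 1, and let T : [0,1] → (0,∞) be measurable with T(y) ≥ T₁ for all y ∈ [0,1]. Then (1/κ)(1 − 2(2/(πκ²T₁))^{1/4}) ≤ 2C₋ ≤ 1/κ and (1/κ)(1 − 2(2/(πκ²T₁))^{1/4}) ≤ 2C₊ ≤ 1/κ. -/
open MeasureTheory Real Set

theorem Mxw_le {T : ℝ} (hT : 0 < T) (v : ℝ) : Mxw T v ≤ (Real.sqrt (2 * π * T))⁻¹ := by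
  have h : Real.exp (-v ^ 2 / (2 * T)) ≤ 1 := by
    rw [Real.exp_le_one_iff]
    exact div_nonpos_of_nonpos_of_nonneg (by nlinarith [sq_nonneg v]) (by positivity)
  exact mul_le_of_le_one_right (by positivity) h

theorem Mxw_eq_gaussian (T : ℝ) :
    Mxw T = fun v => (Real.sqrt (2 * π * T))⁻¹ * Real.exp (-(2 * T)⁻¹ * v ^ 2) := by
  funext v
  unfold Mxw
  congr 2
  ring

theorem integral_Ioi_Mxw {T : ℝ} (hT : 0 < T) : ∫ v in Ioi (0 : ℝ), Mxw T v = 1 / 2 := by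
  have h : π / (2 * T)⁻¹ = 2 * π * T := by field_simp
  have hs : Real.sqrt (2 * π * T) ≠ 0 := by positivity
  rw [Mxw_eq_gaussian, integral_const_mul, integral_gaussian_Ioi, h]
  field_simp

theorem exp_neg_div_le_one {κ a v : ℝ} (hκ : 0 < κ) (ha : 0 ≤ a) (hv : 0 < v) :
    Real.exp (-a / (κ * v)) ≤ 1 := by
  rw [Real.exp_le_one_iff]
  exact div_nonpos_of_nonpos_of_nonneg (by linarith) (by positivity)

theorem integrableOn_exp_mul_Mxw {κ a T : ℝ} (hκ : 0 < κ) (ha : 0 ≤ a) (hT : 0 < T) :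
    IntegrableOn (fun v => Real.exp (-a / (κ * v)) * Mxw T v) (Ioi (0 : ℝ)) := by
  refine Integrable.bdd_mul (c := 1) (integrable_Mxw hT).integrableOn
    (Measurable.aestronglyMeasurable (by fun_prop)) ?_
  filter_upwards [ae_restrict_mem measurableSet_Ioi] with v hv
  rw [Real.norm_eq_abs, abs_of_pos (Real.exp_pos _)]
  exact exp_neg_div_le_one hκ ha hv

theorem integral_exp_mul_Mxw_le {κ a T : ℝ} (hκ : 0 < κ) (ha : 0 ≤ a) (hT : 0 < T) :
    ∫ v in Ioi (0 : ℝ), Real.exp (-a / (κ * v)) * Mxw T v ≤ 1 / 2 := by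
  rw [← integral_Ioi_Mxw hT]
  refine setIntegral_mono_on (integrableOn_exp_mul_Mxw hκ ha hT)
    (integrable_Mxw hT).integrableOn measurableSet_Ioi fun v hv => ?_
  exact mul_le_of_le_one_left (Mxw_nonneg T v) (exp_neg_div_le_one hκ ha hv)

/-- Split the velocity integral at `ε`: below `ε` the Maxwellian is at most its maximum, above `ε`
the exponential is at least `1 - 1 / (κ ε)`. -/
theorem le_integral_exp_mul_Mxw {κ a T ε : ℝ} (hκ : 0 < κ) (ha : 0 ≤ a) (ha1 : a ≤ 1)
    (hT : 0 < T) (hε : 0 < ε) :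
    1 / 2 - ε * (Real.sqrt (2 * π * T))⁻¹ - (κ * ε)⁻¹ / 2 ≤
      ∫ v in Ioi (0 : ℝ), Real.exp (-a / (κ * v)) * Mxw T v := by
  set c := (Real.sqrt (2 * π * T))⁻¹ with hc
  have hM : IntegrableOn (fun v => (1 - (κ * ε)⁻¹) * Mxw T v) (Ioi (0 : ℝ)) :=
    (integrable_Mxw hT).integrableOn.const_mul _
  have hI : IntegrableOn ((Ioc 0 ε).indicator fun _ => c) (Ioi (0 : ℝ)) :=
    ((integrable_indicator_iff measurableSet_Ioc).2
      (integrableOn_const (by simp))).integrableOn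
  have hIint : ∫ v in Ioi (0 : ℝ), (Ioc 0 ε).indicator (fun _ => c) v = ε * c := by
    rw [setIntegral_indicator measurableSet_Ioc,
      inter_eq_self_of_subset_right Ioc_subset_Ioi_self, setIntegral_const]
    simp [hε.le]
  have key : ∫ v in Ioi (0 : ℝ), ((1 - (κ * ε)⁻¹) * Mxw T v - (Ioc 0 ε).indicator (fun _ => c) v)
      ≤ ∫ v in Ioi (0 : ℝ), Real.exp (-a / (κ * v)) * Mxw T v := by
    refine setIntegral_mono_on (hM.sub hI) (integrableOn_exp_mul_Mxw hκ ha hT)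
      measurableSet_Ioi fun v hv => ?_
    have hv0 : 0 < v := hv
    have hMn := Mxw_nonneg T v
    by_cases hvε : v ≤ ε
    · rw [indicator_of_mem (show v ∈ Ioc 0 ε from ⟨hv0, hvε⟩)]
      have h1 : 0 ≤ (κ * ε)⁻¹ * Mxw T v := by positivity
      have h2 : 0 ≤ Real.exp (-a / (κ * v)) * Mxw T v := by positivity
      linarith [Mxw_le hT v]
    · rw [indicator_of_notMem (fun h => hvε h.2), sub_zero]
      refine mul_le_mul_of_nonneg_right ?_ hMn
      have h1 : a / (κ * v) ≤ (κ * ε)⁻¹ := by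
        rw [← one_div]
        have : ε ≤ v := (not_le.1 hvε).le
        gcongr
      have h2 := Real.add_one_le_exp (-a / (κ * v))
      rw [neg_div] at h2 ⊢
      linarith
  rw [integral_sub hM hI, integral_const_mul, integral_Ioi_Mxw hT, hIint] at key
  linarith

theorem sq_rpow_quarter {κ T₁ : ℝ} (hκ : 0 < κ) (hT₁ : 0 < T₁) :
    ((2 / (π * κ ^ 2 * T₁)) ^ ((1 : ℝ) / 4)) ^ 2 = 2 * (Real.sqrt (2 * π * T₁))⁻¹ / κ := by
  have hπ := Real.pi_pos
  have h0 : 0 ≤ 2 / (π * κ ^ 2 * T₁) := by positivity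
  rw [← Real.rpow_natCast, ← Real.rpow_mul h0]
  norm_num only
  rw [← Real.sqrt_eq_rpow, Real.sqrt_eq_iff_mul_self_eq h0 (by positivity)]
  have hs := Real.sq_sqrt (show 0 ≤ 2 * π * T₁ by positivity)
  have hs0 : Real.sqrt (2 * π * T₁) ≠ 0 := by positivity
  field_simp
  rw [hs]

theorem le_two_mul_integral_exp_mul_Mxw {κ T₁ a T : ℝ} (hκ : 0 < κ) (hT₁ : 0 < T₁)
    (ha : 0 ≤ a) (ha1 : a ≤ 1) (hT : T₁ ≤ T) :
    (1 - 2 * (2 / (π * κ ^ 2 * T₁)) ^ ((1 : ℝ) / 4)) / 2 ≤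
      ∫ v in Ioi (0 : ℝ), Real.exp (-a / (κ * v)) * Mxw T v := by
  have hsq := sq_rpow_quarter hκ hT₁
  have hπ := Real.pi_pos
  have hD : 0 < (2 / (π * κ ^ 2 * T₁)) ^ ((1 : ℝ) / 4) := by positivity
  set D := (2 / (π * κ ^ 2 * T₁)) ^ ((1 : ℝ) / 4)
  have h := le_integral_exp_mul_Mxw hκ ha ha1 (hT₁.trans_le hT)
    (show 0 < (κ * D)⁻¹ by positivity)
  have h1 : (κ * (κ * D)⁻¹)⁻¹ = D := by field_simp
  have h2 : (κ * D)⁻¹ * (Real.sqrt (2 * π * T₁))⁻¹ = D / 2 := by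
    have : (Real.sqrt (2 * π * T₁))⁻¹ = D ^ 2 * κ / 2 := by rw [hsq]; field_simp
    rw [this]
    field_simp
  have h3 : (κ * D)⁻¹ * (Real.sqrt (2 * π * T))⁻¹ ≤
      (κ * D)⁻¹ * (Real.sqrt (2 * π * T₁))⁻¹ := by
    gcongr
  rw [h1] at h
  linarith

/-- Bounds for the weighted average of the damped half-Maxwellian mass, for a general optical
depth `a` with values in `[0, 1]`. -/
theorem weighted_integral_bounds {κ T₁ : ℝ} (hκ : 0 < κ) (hT₁ : 0 < T₁) {ρ T a : ℝ → ℝ}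
    (hρnn : ∀ y, 0 ≤ ρ y) (hρint : (∫ y in Icc (0 : ℝ) 1, ρ y) = 1)
    (hTmeas : Measurable T) (hT : ∀ y ∈ Icc (0 : ℝ) 1, T₁ ≤ T y)
    (hameas : Measurable a) (ha : ∀ y ∈ Icc (0 : ℝ) 1, a y ∈ Icc (0 : ℝ) 1) :
    κ⁻¹ * (1 - 2 * (2 / (π * κ ^ 2 * T₁)) ^ ((1 : ℝ) / 4)) ≤
      2 * (κ⁻¹ * ∫ y in Icc (0 : ℝ) 1,
        ρ y * ∫ v in Ioi (0 : ℝ), Real.exp (-a y / (κ * v)) * Mxw (T y) v) ∧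
    2 * (κ⁻¹ * ∫ y in Icc (0 : ℝ) 1,
      ρ y * ∫ v in Ioi (0 : ℝ), Real.exp (-a y / (κ * v)) * Mxw (T y) v) ≤ κ⁻¹ := by
  set G : ℝ → ℝ := fun y => ∫ v in Ioi (0 : ℝ), Real.exp (-a y / (κ * v)) * Mxw (T y) v with hG
  set D := (2 / (π * κ ^ 2 * T₁)) ^ ((1 : ℝ) / 4)
  have hρi : IntegrableOn ρ (Icc (0 : ℝ) 1) := by
    by_contra h
    rw [integral_undef h] at hρint
    exact zero_ne_one hρint
  have hGmeas : StronglyMeasurable G := by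
    refine StronglyMeasurable.integral_prod_right
      (f := fun y v => Real.exp (-a y / (κ * v)) * Mxw (T y) v) ?_
    unfold Mxw
    exact Measurable.stronglyMeasurable (by fun_prop)
  have hlo : ∀ y ∈ Icc (0 : ℝ) 1, (1 - 2 * D) / 2 ≤ G y := fun y hy =>
    le_two_mul_integral_exp_mul_Mxw hκ hT₁ (ha y hy).1 (ha y hy).2 (hT y hy)
  have hup : ∀ y ∈ Icc (0 : ℝ) 1, G y ≤ 1 / 2 := fun y hy =>
    integral_exp_mul_Mxw_le hκ (ha y hy).1 (hT₁.trans_le (hT y hy))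
  have hG0 : ∀ y, 0 ≤ G y := fun y =>
    integral_nonneg fun v => mul_nonneg (Real.exp_pos _).le (Mxw_nonneg _ _)
  have hint : IntegrableOn (fun y => ρ y * G y) (Icc (0 : ℝ) 1) := by
    refine Integrable.mul_bdd (c := 1 / 2) hρi hGmeas.aestronglyMeasurable ?_
    filter_upwards [ae_restrict_mem measurableSet_Icc] with y hy
    rw [Real.norm_eq_abs, abs_of_nonneg (hG0 y)]
    exact hup y hy
  have hL : (1 - 2 * D) / 2 ≤ ∫ y in Icc (0 : ℝ) 1, ρ y * G y := by
    calc (1 - 2 * D) / 2 = ∫ y in Icc (0 : ℝ) 1, ρ y * ((1 - 2 * D) / 2) := by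
          rw [integral_mul_const, hρint, one_mul]
      _ ≤ _ := setIntegral_mono_on (hρi.mul_const _) hint measurableSet_Icc
          fun y hy => mul_le_mul_of_nonneg_left (hlo y hy) (hρnn y)
  have hU : ∫ y in Icc (0 : ℝ) 1, ρ y * G y ≤ 1 / 2 := by
    calc _ ≤ ∫ y in Icc (0 : ℝ) 1, ρ y * (1 / 2) :=
          setIntegral_mono_on hint (hρi.mul_const _) measurableSet_Icc
            fun y hy => mul_le_mul_of_nonneg_left (hup y hy) (hρnn y)
      _ = 1 / 2 := by rw [integral_mul_const, hρint, one_mul]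
  have hκ' : 0 < κ⁻¹ := inv_pos.2 hκ
  constructor <;> nlinarith

/-- two-sided bounds on `C₋` and `C₊` when `T(y) ≥ T₁`. -/
theorem Cminus_Cplus_bounds (κ T₁ : ℝ) (hκ : 0 < κ) (hT₁ : 0 < T₁)
    (ρ T : ℝ → ℝ) (hρmeas : Measurable ρ) (hρnn : ∀ y, 0 ≤ ρ y)
    (hρint : (∫ y in Icc (0 : ℝ) 1, ρ y) = 1)
    (hTmeas : Measurable T) (hT : ∀ y ∈ Icc (0 : ℝ) 1, T₁ ≤ T y) (hTpos : ∀ y, 0 < T y) :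
    κ⁻¹ * (1 - 2 * (2 / (π * κ ^ 2 * T₁)) ^ ((1 : ℝ) / 4)) ≤ 2 * Cminus κ ρ T ∧
    2 * Cminus κ ρ T ≤ κ⁻¹ ∧
    κ⁻¹ * (1 - 2 * (2 / (π * κ ^ 2 * T₁)) ^ ((1 : ℝ) / 4)) ≤ 2 * Cplus κ ρ T ∧
    2 * Cplus κ ρ T ≤ κ⁻¹ := by
  obtain ⟨h1, h2⟩ := weighted_integral_bounds hκ hT₁ hρnn hρint hTmeas hT measurable_id
    fun _ hy => hy
  obtain ⟨h3, h4⟩ := weighted_integral_bounds (a := fun y => 1 - y) hκ hT₁ hρnn hρint hTmeas hT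
    (by fun_prop) fun _ hy => ⟨by linarith [hy.2], by linarith [hy.1]⟩
  exact ⟨h1, h2, h3, h4⟩
end

section
/- For all a > 0, κ > 0 and T > 0, ∫₀^∞ (1/(κv)) e^{−a/(κv)} M_T(v) dv ≤ e^{−1/2} (2/(πκ²T))^{1/4} a^{−1/2}. -/
open MeasureTheory Real Set

theorem Gamma_one_fourth_le_four : Real.Gamma (1 / 4) ≤ 4 := by
  have hconv := Real.convexOn_Gamma.2 (mem_Ioi.2 one_pos) (mem_Ioi.2 two_pos)
    (by norm_num : (0 : ℝ) ≤ 3 / 4) (by norm_num : (0 : ℝ) ≤ 1 / 4) (by norm_num)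
  have hrec := Real.Gamma_add_one (s := 1 / 4) (by norm_num)
  simp only [smul_eq_mul, Real.Gamma_one, Real.Gamma_two] at hconv
  norm_num at hconv hrec ⊢
  linarith

theorem inv_mul_exp_neg_div_le {a κ v : ℝ} (ha : 0 < a) (hκ : 0 < κ) (hv : 0 < v) :
    (κ * v)⁻¹ * Real.exp (-a / (κ * v)) ≤
      Real.exp (-(1 : ℝ) / 2) * (2 * a * κ) ^ (-(1 : ℝ) / 2) * v ^ (-(1 : ℝ) / 2) := by
  refine le_of_sq_le_sq ?_ (by positivity)
  have hexp := Real.add_one_le_exp (2 * a / (κ * v) - 1)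
  simp only [mul_pow, ← Real.exp_nat_mul, ← Real.rpow_mul_natCast hv.le,
    ← Real.rpow_mul_natCast (by positivity : 0 ≤ 2 * a * κ)]
  norm_num [Real.rpow_neg_one]
  rw [show 2 * (-a / (κ * v)) = -1 - (2 * a / (κ * v) - 1) by ring, Real.exp_sub]
  have hle : 2 * a / (κ * v) ≤ Real.exp (2 * a / (κ * v) - 1) := by linarith
  calc _ = (κ * v)⁻¹ ^ 2 * Real.exp (-1) * (Real.exp (2 * a / (κ * v) - 1))⁻¹ := by
        field_simp
    _ ≤ (κ * v)⁻¹ ^ 2 * Real.exp (-1) * (2 * a / (κ * v))⁻¹ := by gcongr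
    _ = _ := by field_simp

/-- `∫₀^∞ (1/(κv)) e^{−a/(κv)} M_T(v) dv ≤ e^{−1/2} (2/(πκ²T))^{1/4} a^{−1/2}`. -/
theorem exp_kernel_density_bound (a κ T : ℝ) (ha : 0 < a) (hκ : 0 < κ) (hT : 0 < T) :
    (∫ v in Ioi (0 : ℝ), (κ * v)⁻¹ * Real.exp (-a / (κ * v)) * Mxw T v) ≤
      Real.exp (-(1 : ℝ) / 2) * (2 / (π * κ ^ 2 * T)) ^ ((1 : ℝ) / 4) * a ^ (-(1 : ℝ) / 2) := by
  have hdom : IntegrableOn (fun v : ℝ => v ^ (-(1 : ℝ) / 2) * Real.exp (-(2 * T)⁻¹ * v ^ (2 : ℝ)))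
      (Ioi 0) :=
    integrableOn_rpow_mul_exp_neg_mul_rpow (by norm_num) (by norm_num) (by positivity)
  have hint : (∫ v in Ioi (0 : ℝ), v ^ (-(1 : ℝ) / 2) * Real.exp (-(2 * T)⁻¹ * v ^ (2 : ℝ))) ≤
      2 * (2 * T) ^ ((1 : ℝ) / 4) := by
    rw [integral_rpow_mul_exp_neg_mul_rpow (by norm_num) (by norm_num) (by positivity),
      Real.inv_rpow (by positivity), ← Real.rpow_neg (by positivity)]
    norm_num
    have hpos : 0 < (2 * T) ^ ((1 : ℝ) / 4) := by positivity
    nlinarith [Gamma_one_fourth_le_four]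
  set C := Real.exp (-(1 : ℝ) / 2) * (2 * a * κ) ^ (-(1 : ℝ) / 2) * (Real.sqrt (2 * π * T))⁻¹
    with hC
  have hC0 : 0 ≤ C := by positivity
  calc
    _ ≤ ∫ v in Ioi (0 : ℝ),
        C * (v ^ (-(1 : ℝ) / 2) * Real.exp (-(2 * T)⁻¹ * v ^ (2 : ℝ))) := by
      refine integral_mono_of_nonneg ?_ (hdom.const_mul C) ?_
      · filter_upwards [ae_restrict_mem measurableSet_Ioi] with v hv
        have hv' : 0 < v := hv
        simp only [Mxw, Pi.zero_apply]
        positivity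
      · filter_upwards [ae_restrict_mem measurableSet_Ioi] with v hv
        have hexp : -v ^ 2 / (2 * T) = -(2 * T)⁻¹ * v ^ (2 : ℝ) := by
          rw [Real.rpow_two]; ring
        calc _ ≤ _ * Mxw T v := mul_le_mul_of_nonneg_right
              (inv_mul_exp_neg_div_le ha hκ hv) (by unfold Mxw; positivity)
          _ = _ := by rw [Mxw, hexp, hC]; ring
    _ ≤ C * (2 * (2 * T) ^ ((1 : ℝ) / 4)) := by
      rw [integral_const_mul]
      gcongr
    _ ≤ _ := by
      rw [hC, Real.sqrt_eq_rpow, ← Real.rpow_neg (by positivity)]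
      refine le_of_pow_le_pow_left₀ (n := 4) (by norm_num) (by positivity) ?_
      simp only [mul_pow, ← Real.rpow_mul_natCast ha.le,
        ← Real.rpow_mul_natCast (by positivity : 0 ≤ 2 * a * κ),
        ← Real.rpow_mul_natCast (by positivity : 0 ≤ 2 * π * T),
        ← Real.rpow_mul_natCast (by positivity : 0 ≤ 2 * T),
        ← Real.rpow_mul_natCast (by positivity : 0 ≤ 2 / (π * κ ^ 2 * T))]
      norm_num
      have hπ : 1 ≤ π := by linarith [Real.pi_gt_three]
      calc _ = Real.exp (-(1 / 2)) ^ 4 * (2 / (π * κ ^ 2 * T)) * (a ^ 2)⁻¹ * π⁻¹ := by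
            field_simp
            norm_num
        _ ≤ _ := mul_le_of_le_one_right (by positivity) (inv_le_one_of_one_le₀ hπ)
end

section
/- For all κ > 0 and T > 0, ∫₀^∞ e^{−1/(κv)} M̃_T(v) dv ≥ √(π/(2T)) · (1 − 2(2/(πκ²T))^{1/4}). -/
open MeasureTheory Real Set

lemma wallMxw_eq (T : ℝ) : wallMxw T = fun v => T⁻¹ * Real.exp (-(1 / (2 * T)) * v ^ 2) := by
  funext v
  unfold wallMxw
  congr 2
  ring

lemma integrable_wallMxw {T : ℝ} (hT : 0 < T) : Integrable (wallMxw T) := by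
  rw [wallMxw_eq]
  exact (integrable_exp_neg_mul_sq (by positivity)).const_mul _

lemma integral_Ioi_wallMxw {T : ℝ} (hT : 0 < T) :
    ∫ v in Ioi (0 : ℝ), wallMxw T v = Real.sqrt (π / (2 * T)) := by
  rw [wallMxw_eq, integral_const_mul, integral_gaussian_Ioi]
  symm
  rw [Real.sqrt_eq_iff_mul_self_eq (by positivity) (by positivity)]
  symm
  have h := Real.mul_self_sqrt (show 0 ≤ π / (1 / (2 * T)) by positivity)
  calc T⁻¹ * (√(π / (1 / (2 * T))) / 2) * (T⁻¹ * (√(π / (1 / (2 * T))) / 2))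
      = T⁻¹ ^ 2 / 4 * (√(π / (1 / (2 * T))) * √(π / (1 / (2 * T)))) := by ring
    _ = π / (2 * T) := by
      rw [h]
      field_simp
      norm_num

lemma wallMxw_nonneg {T : ℝ} (hT : 0 < T) (v : ℝ) : 0 ≤ wallMxw T v := by
  unfold wallMxw
  positivity

lemma wallMxw_le_inv {T : ℝ} (hT : 0 < T) (v : ℝ) : wallMxw T v ≤ T⁻¹ := by
  unfold wallMxw
  refine mul_le_of_le_one_right (by positivity) (Real.exp_le_one_iff.2 ?_)
  exact div_nonpos_of_nonpos_of_nonneg (by nlinarith [sq_nonneg v]) (by positivity)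

lemma integrableOn_exp_mul_wallMxw {κ T : ℝ} (hκ : 0 < κ) (hT : 0 < T) :
    IntegrableOn (fun v => Real.exp (-1 / (κ * v)) * wallMxw T v) (Ioi 0) := by
  refine (integrable_wallMxw hT).integrableOn.bdd_mul (c := 1)
    (by fun_prop : Measurable fun v : ℝ => Real.exp (-1 / (κ * v))).aestronglyMeasurable ?_
  filter_upwards [ae_restrict_mem measurableSet_Ioi] with v hv
  rw [Real.norm_eq_abs, Real.abs_exp, Real.exp_le_one_iff]
  have : 0 < κ * v := mul_pos hκ hv
  exact div_nonpos_of_nonpos_of_nonneg (by norm_num) this.le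

/-- Truncating the integral at velocity `a` loses at most `a / T`, and `e^{-1/(κv)}` is at least
`1 - 1/(κa)` beyond it. -/
lemma sub_le_integral_exp_mul_wallMxw {κ T a : ℝ} (hκ : 0 < κ) (hT : 0 < T) (ha : 0 < a) :
    (1 - 1 / (κ * a)) * Real.sqrt (π / (2 * T)) - a * T⁻¹ ≤
      ∫ v in Ioi (0 : ℝ), Real.exp (-1 / (κ * v)) * wallMxw T v := by
  have hM : IntegrableOn (fun v => (1 - 1 / (κ * a)) * wallMxw T v) (Ioi 0) :=
    (integrable_wallMxw hT).integrableOn.const_mul _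
  have hI : Integrable ((Ioc 0 a).indicator fun _ : ℝ => T⁻¹) :=
    (integrable_indicator_iff measurableSet_Ioc).2 (by simp)
  have hint : ∫ v in Ioi (0 : ℝ), (Ioc 0 a).indicator (fun _ : ℝ => T⁻¹) v = a * T⁻¹ := by
    rw [setIntegral_indicator measurableSet_Ioc, inter_eq_right.2 Ioc_subset_Ioi_self]
    simp [ha.le]
  rw [← integral_Ioi_wallMxw hT, ← integral_const_mul, ← hint,
    ← integral_sub hM hI.integrableOn]
  refine setIntegral_mono_on (hM.sub hI.integrableOn) (integrableOn_exp_mul_wallMxw hκ hT)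
    measurableSet_Ioi fun v (hv : 0 < v) => ?_
  have h0 := wallMxw_nonneg hT v
  have hc : 0 < 1 / (κ * a) := by positivity
  by_cases hva : v ≤ a
  · rw [indicator_of_mem (show v ∈ Ioc 0 a from ⟨hv, hva⟩)]
    have h1 := wallMxw_le_inv hT v
    have h2 : 0 ≤ Real.exp (-1 / (κ * v)) * wallMxw T v := by positivity
    nlinarith [mul_nonneg hc.le h0]
  · rw [indicator_of_notMem fun h => hva h.2, sub_zero]
    refine mul_le_mul_of_nonneg_right ?_ h0
    have h1 : 1 / (κ * v) ≤ 1 / (κ * a) := by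
      have := (not_le.1 hva).le
      gcongr
    have h2 := Real.add_one_le_exp (-1 / (κ * v))
    rw [neg_div] at h2 ⊢
    linarith

/-- lower bound on `∫₀^∞ e^{−1/(κv)} M̃_T(v) dv`. -/
theorem wall_maxwellian_exp_lower_bound (κ T : ℝ) (hκ : 0 < κ) (hT : 0 < T) :
    Real.sqrt (π / (2 * T)) * (1 - 2 * (2 / (π * κ ^ 2 * T)) ^ ((1 : ℝ) / 4)) ≤
      ∫ v in Ioi (0 : ℝ), Real.exp (-1 / (κ * v)) * wallMxw T v := by
  set q : ℝ := (2 / (π * κ ^ 2 * T)) ^ ((1 : ℝ) / 4) with hq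
  set S := Real.sqrt (π / (2 * T)) with hS
  have hq0 : 0 < q := by positivity
  have hq4 : q ^ 4 = 2 / (π * κ ^ 2 * T) := by
    rw [hq, ← Real.rpow_natCast, ← Real.rpow_mul (by positivity)]
    norm_num
  have hS2 : S ^ 2 = π / (2 * T) := Real.sq_sqrt (by positivity)
  have hopt : S * q ^ 2 * κ * T = 1 := by
    rw [← pow_left_inj₀ (by positivity) zero_le_one two_ne_zero]
    calc (S * q ^ 2 * κ * T) ^ 2 = S ^ 2 * q ^ 4 * κ ^ 2 * T ^ 2 := by ring
      _ = 1 ^ 2 := by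
        rw [hS2, hq4]
        field_simp
  have h := sub_le_integral_exp_mul_wallMxw hκ hT (a := 1 / (κ * q)) (by positivity)
  have h1 : 1 / (κ * (1 / (κ * q))) = q := by field_simp
  have h2 : 1 / (κ * q) * T⁻¹ = S * q := by
    field_simp
    linarith
  rw [h1, h2, ← hS] at h
  linarith
end

section
/- Let κ > 0, let T : [0,1] → (0,∞) be continuous, and let f : [0,1] × ℝ → [0,∞) be such that for each v ∈ ℝ the map x ↦ f(x,v) is continuously differentiable and satisfies v ∂_x f(x,v) = (1/κ)(ρ(x) M_{T(x)}(v) − f(x,v)) for all x ∈ [0,1], where ρ(x) = ∫_ℝ f(x,v) dv is finite. Assume that for k = 0, 1, 2 the maps v ↦ v^k f(x,v) and v ↦ v^k ∂_x f(x,v) are integrable, that for k = 1, 2 the map x ↦ ∫_ℝ v^k f(x,v) dv is differentiable with derivative ∫_ℝ v^k ∂_x f(x,v) dv, and that f satisfies the diffusive boundary conditions: f(0,v) = M̃_{T₁}(v) ∫_{v'<0} |v'| f(0,v') dv' for v > 0 and f(1,v) = M̃_{T₂}(v) ∫_{v'>0} |v'| f(1,v') dv' for v < 0, with T₁, T₂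 > 0. Then ∫_ℝ v f(x,v) dv = 0 for all x ∈ [0,1], and x ↦ ∫_ℝ v² f(x,v) dv is constant on [0,1]; i.e. the steady state has zero momentum and constant pressure. -/
open MeasureTheory Real Set

theorem integral_Mxw {T : ℝ} (hT : 0 < T) : ∫ v, Mxw T v = 1 := by
  have h : ∀ v, Mxw T v = (√(2 * π * T))⁻¹ * Real.exp (-(1 / (2 * T)) * v ^ 2) := by
    intro v
    unfold Mxw
    congr 2
    ring
  simp_rw [h]
  rw [integral_const_mul, integral_gaussian]
  have h2 : π / (1 / (2 * T)) = 2 * π * T := by field_simp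
  rw [h2]
  exact inv_mul_cancel₀ (by positivity)

theorem integrable_mul_Mxw {T : ℝ} (hT : 0 < T) : Integrable fun v => v * Mxw T v := by
  have h := (integrable_mul_exp_neg_mul_sq (b := 1 / (2 * T)) (by positivity)).const_mul
    (√(2 * π * T))⁻¹
  refine h.congr (ae_of_all _ fun v => ?_)
  have hv : -v ^ 2 / (2 * T) = -(1 / (2 * T)) * v ^ 2 := by ring
  simp only [Mxw, hv]
  ring

theorem integral_mul_Mxw (T : ℝ) : ∫ v, v * Mxw T v = 0 := by
  have h := integral_neg_eq_self (fun v => v * Mxw T v) volume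
  have h2 : ∀ v, -v * Mxw T (-v) = -(v * Mxw T v) := by
    intro v
    simp [Mxw]
  simp only [h2, integral_neg] at h
  linarith

theorem integral_Ioi_mul_wallMxw {T : ℝ} (hT : 0 < T) :
    ∫ v in Ioi (0 : ℝ), v * wallMxw T v = 1 := by
  have h := integral_mul_cexp_neg_mul_sq (b := ((1 / (2 * T) : ℝ) : ℂ))
    (by rw [Complex.ofReal_re]; positivity)
  have h2 : ∫ v in Ioi (0 : ℝ), v * Real.exp (-(1 / (2 * T)) * v ^ 2) = T := by
    have hc : (2 * ((1 / (2 * T) : ℝ) : ℂ))⁻¹ = ((T : ℝ) : ℂ) := by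
      have hT' : (T : ℂ) ≠ 0 := by exact_mod_cast hT.ne'
      push_cast
      field_simp
    rw [hc] at h
    have hi : ∀ r : ℝ, (r : ℂ) * Complex.exp (-((1 / (2 * T) : ℝ) : ℂ) * (r : ℂ) ^ 2)
        = ((r * Real.exp (-(1 / (2 * T)) * r ^ 2) : ℝ) : ℂ) := by
      intro r
      push_cast
      rfl
    simp_rw [hi] at h
    rw [integral_complex_ofReal] at h
    exact_mod_cast h
  have h3 : ∀ v, v * wallMxw T v = T⁻¹ * (v * Real.exp (-(1 / (2 * T)) * v ^ 2)) := by
    intro v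
    have hv : -v ^ 2 / (2 * T) = -(1 / (2 * T)) * v ^ 2 := by ring
    simp only [wallMxw, hv]
    ring
  simp_rw [h3]
  rw [integral_const_mul, h2, inv_mul_cancel₀ hT.ne']

/-- A distribution whose outgoing half is the wall Maxwellian emitting exactly the incoming flux
has zero momentum. -/
theorem integral_mul_eq_zero_of_diffuse_reflection {T : ℝ} (hT : 0 < T) {g : ℝ → ℝ}
    (hg : Integrable fun v => v * g v)
    (hbc : ∀ v > (0 : ℝ), g v = wallMxw T v * ∫ w in Iio (0 : ℝ), |w| * g w) :
    ∫ v, v * g v = 0 := by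
  set J := ∫ w in Iio (0 : ℝ), |w| * g w with hJ
  have hpos : ∫ v in Ioi (0 : ℝ), v * g v = J := by
    have h : ∫ v in Ioi (0 : ℝ), v * g v = ∫ v in Ioi (0 : ℝ), v * wallMxw T v * J :=
      setIntegral_congr_fun measurableSet_Ioi fun v hv => by
        simp only [hbc v hv, mul_assoc]
    rw [h, integral_mul_const, integral_Ioi_mul_wallMxw hT, one_mul]
  have hneg : ∫ v in Iio (0 : ℝ), v * g v = -J := by
    rw [hJ, ← integral_neg]
    refine setIntegral_congr_fun measurableSet_Iio fun v hv => ?_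
    simp only [abs_of_neg (mem_Iio.mp hv)]
    ring
  have hsplit := intervalIntegral.integral_Iio_add_Ici (b := (0 : ℝ)) hg.integrableOn hg.integrableOn
  rw [integral_Ici_eq_integral_Ioi, hpos, hneg, neg_add_cancel] at hsplit
  exact hsplit.symm

theorem eq_left_of_hasDerivAt_zero {F : ℝ → ℝ} {a b : ℝ}
    (hF : ∀ x ∈ Icc a b, HasDerivAt F 0 x) : ∀ x ∈ Icc a b, F x = F a :=
  constant_of_has_deriv_right_zero (fun x hx => (hF x hx).continuousAt.continuousWithinAt)
    fun x hx => (hF x (Ico_subset_Icc_self hx)).hasDerivWithinAt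

/-- a steady state of the linear BGK equation with diffusive boundary
conditions has zero momentum and constant pressure. -/
theorem zero_momentum_constant_pressure (κ T₁ T₂ : ℝ) (hκ : 0 < κ) (hT₁ : 0 < T₁) (hT₂ : 0 < T₂)
    (T : ℝ → ℝ) (hTcont : ContinuousOn T (Icc 0 1)) (hTpos : ∀ x, 0 < T x)
    (f fx : ℝ → ℝ → ℝ) (hfnn : ∀ x v, 0 ≤ f x v)
    (hderiv : ∀ v : ℝ, ∀ x ∈ Icc (0 : ℝ) 1, HasDerivAt (fun x' => f x' v) (fx x v) x)
    (hpde : ∀ x ∈ Icc (0 : ℝ) 1, ∀ v : ℝ,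
      v * fx x v = κ⁻¹ * ((∫ w, f x w) * Mxw (T x) v - f x v))
    (hρfin : ∀ x ∈ Icc (0 : ℝ) 1, Integrable (fun v => f x v))
    (hint : ∀ x ∈ Icc (0 : ℝ) 1, ∀ k : ℕ, k ≤ 2 →
      Integrable (fun v => v ^ k * f x v) ∧ Integrable (fun v => v ^ k * fx x v))
    (hdiff : ∀ k : ℕ, (k = 1 ∨ k = 2) → ∀ x ∈ Icc (0 : ℝ) 1,
      HasDerivAt (fun x' => ∫ v, v ^ k * f x' v) (∫ v, v ^ k * fx x v) x)
    (hbc0 : ∀ v > (0 : ℝ), f 0 v = wallMxw T₁ v * ∫ v' in Iio (0 : ℝ), |v'| * f 0 v')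
    (hbc1 : ∀ v < (0 : ℝ), f 1 v = wallMxw T₂ v * ∫ v' in Ioi (0 : ℝ), |v'| * f 1 v') :
    (∀ x ∈ Icc (0 : ℝ) 1, (∫ v, v * f x v) = 0) ∧
    (∀ x₁ ∈ Icc (0 : ℝ) 1, ∀ x₂ ∈ Icc (0 : ℝ) 1,
      (∫ v, v ^ 2 * f x₁ v) = ∫ v, v ^ 2 * f x₂ v) := by
  have hmom_deriv : ∀ x ∈ Icc (0 : ℝ) 1, ∫ v, v ^ 1 * fx x v = 0 := by
    intro x hx
    simp_rw [pow_one, hpde x hx]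
    rw [integral_const_mul, integral_sub ((integrable_Mxw (hTpos x)).const_mul _) (hρfin x hx),
      integral_const_mul, integral_Mxw (hTpos x)]
    ring
  have hint1 : ∀ x ∈ Icc (0 : ℝ) 1, Integrable fun v => v * f x v := fun x hx => by
    simpa only [pow_one] using (hint x hx 1 one_le_two).1
  have hmom : ∀ x ∈ Icc (0 : ℝ) 1, (∫ v, v * f x v) = 0 := by
    intro x hx
    have h := eq_left_of_hasDerivAt_zero
      (fun y hy => hmom_deriv y hy ▸ hdiff 1 (Or.inl rfl) y hy) x hx
    simp only [pow_one] at h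
    rw [h]
    exact integral_mul_eq_zero_of_diffuse_reflection hT₁ (hint1 0 (by simp)) hbc0
  refine ⟨hmom, ?_⟩
  have hpres_deriv : ∀ x ∈ Icc (0 : ℝ) 1, ∫ v, v ^ 2 * fx x v = 0 := by
    intro x hx
    have h : ∀ v, v ^ 2 * fx x v
        = κ⁻¹ * ((∫ w, f x w) * (v * Mxw (T x) v) - v * f x v) := by
      intro v
      rw [sq, mul_assoc, hpde x hx v]
      ring
    simp_rw [h]
    rw [integral_const_mul, integral_sub ((integrable_mul_Mxw (hTpos x)).const_mul _) (hint1 x hx),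
      integral_const_mul, integral_mul_Mxw, hmom x hx]
    ring
  have hconst := eq_left_of_hasDerivAt_zero
    fun y hy => hpres_deriv y hy ▸ hdiff 2 (Or.inr rfl) y hy
  intro x₁ hx₁ x₂ hx₂
  exact (hconst x₁ hx₁).trans (hconst x₂ hx₂).symm
end
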